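/- For every integer n ≥ 3, the topological boundary of 𝒜_{3,n} is contained in the union of ℬ⁺_n and ℬ⁻_n. -/

import Mathlib

/-- The Minkowski sum of `n` copies of the twisted cubic segment
`{(t, t^2, t^3) : -1 <= t <= 1}`. -/
def A3 (n : ℕ) : Set (ℝ × ℝ × ℝ) :=
  {p | ∃ t : Fin n → ℝ, (∀ i, -1 ≤ t i ∧ t i ≤ 1) ∧
       p = (∑ i, t i, ∑ i, (t i) ^ 2, ∑ i, (t i) ^ 3)}

/-- The set `C⁺_{k,a}`. -/
def Cplus (k a : ℕ) : Set (ℝ × ℝ × ℝ) :=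
  {p | ∃ s t : ℝ, -1 ≤ s ∧ s ≤ t ∧ t ≤ 1 ∧
       p = ((k : ℝ) * s + t + a, (k : ℝ) * s ^ 2 + t ^ 2 + a, (k : ℝ) * s ^ 3 + t ^ 3 + a)}

/-- The set `C⁻_{ℓ,b}`. -/
def Cminus (l b : ℕ) : Set (ℝ × ℝ × ℝ) :=
  {p | ∃ s t : ℝ, -1 ≤ s ∧ s ≤ t ∧ t ≤ 1 ∧
       p = (s + (l : ℝ) * t - b, s ^ 2 + (l : ℝ) * t ^ 2 + b, s ^ 3 + (l : ℝ) * t ^ 3 - b)}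

/-- The set `ℬ⁺_n`. -/
def Bplus (n : ℕ) : Set (ℝ × ℝ × ℝ) := ⋃ k ∈ Finset.Icc 1 (n - 1), Cplus k (n - k - 1)

/-- The set `ℬ⁻_n`. -/
def Bminus (n : ℕ) : Set (ℝ × ℝ × ℝ) := ⋃ l ∈ Finset.Icc 1 (n - 1), Cminus l (n - l - 1)

/-- The squared Euclidean distance from the power sums of `x` to `(q₁, q₂, q₃)`. -/
def momentDistSq {n : ℕ} (q₁ q₂ q₃ : ℝ) (x : Fin n → ℝ) : ℝ :=
  (∑ i, x i - q₁) ^ 2 + (∑ i, x i ^ 2 - q₂) ^ 2 + (∑ i, x i ^ 3 - q₃) ^ 2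

/-- `x` minimizes the distance from its power sums to `(q₁, q₂, q₃)` over the cube. -/
def IsNearest {n : ℕ} (q₁ q₂ q₃ : ℝ) (x : Fin n → ℝ) : Prop :=
  (∀ i, -1 ≤ x i ∧ x i ≤ 1) ∧
    ∀ y : Fin n → ℝ, (∀ i, -1 ≤ y i ∧ y i ≤ 1) →
      momentDistSq q₁ q₂ q₃ x ≤ momentDistSq q₁ q₂ q₃ y

theorem sum_comp_update {n : ℕ} (h : ℝ → ℝ) (x : Fin n → ℝ) (i : Fin n) (y : ℝ) :
    ∑ j, h (Function.update x i y j) = ∑ j, h (x j) + (h y - h (x i)) := by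
  rw [← Finset.add_sum_erase _ _ (Finset.mem_univ i),
    ← Finset.add_sum_erase Finset.univ (fun j => h (x j)) (Finset.mem_univ i)]
  rw [Finset.sum_congr rfl (g := fun j => h (x j))]
  · rw [Function.update_self]
    ring
  · intro j hj
    rw [Function.update_of_ne (Finset.ne_of_mem_erase hj)]

theorem nonneg_at_zero_of_pos {F : ℝ → ℝ} (hF : Continuous F) {δ : ℝ} (hδ : 0 < δ)
    (h : ∀ ε, 0 < ε → ε < δ → 0 ≤ F ε) : 0 ≤ F 0 := by
  have ht : Filter.Tendsto F (nhdsWithin 0 (Set.Ioi 0)) (nhds (F 0)) :=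
    hF.continuousAt.tendsto.mono_left nhdsWithin_le_nhds
  refine ge_of_tendsto ht ?_
  filter_upwards [Ioo_mem_nhdsGT hδ] with ε hε using h ε hε.1 hε.2

theorem IsNearest.mul_deriv_nonneg {n : ℕ} {q₁ q₂ q₃ : ℝ} {x : Fin n → ℝ}
    (hx : IsNearest q₁ q₂ q₃ x) (i : Fin n) (σ : ℝ) {δ : ℝ} (hδ : 0 < δ)
    (hσ : ∀ ε, 0 < ε → ε < δ → -1 ≤ x i + σ * ε ∧ x i + σ * ε ≤ 1) :
    0 ≤ σ * ((∑ j, x j - q₁) + 2 * (∑ j, x j ^ 2 - q₂) * x i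
      + 3 * (∑ j, x j ^ 3 - q₃) * x i ^ 2) := by
  set a := ∑ j, x j - q₁ with ha
  set b := ∑ j, x j ^ 2 - q₂ with hb
  set c := ∑ j, x j ^ 3 - q₃ with hc
  set s := x i with hs
  let A : ℝ → ℝ := fun _ => σ
  let B : ℝ → ℝ := fun ε => σ * (2 * s + σ * ε)
  let C : ℝ → ℝ := fun ε => σ * (3 * s ^ 2 + 3 * s * (σ * ε) + (σ * ε) ^ 2)
  have key := nonneg_at_zero_of_pos
    (F := fun ε => 2 * (a * A ε + b * B ε + c * C ε) + ε * (A ε ^ 2 + B ε ^ 2 + C ε ^ 2))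
    (by fun_prop) hδ (fun ε h0 h1 => by
      have hm := hx.2 (Function.update x i (s + σ * ε)) (fun j => by
        rcases eq_or_ne j i with rfl | hj
        · simpa using hσ ε h0 h1
        · simpa [Function.update_of_ne hj] using hx.1 j)
      unfold momentDistSq at hm
      rw [sum_comp_update (fun t => t), sum_comp_update (fun t => t ^ 2),
        sum_comp_update (fun t => t ^ 3)] at hm
      have e1 : ∑ j, x j = a + q₁ := by rw [ha]; ring
      have e2 : ∑ j, x j ^ 2 = b + q₂ := by rw [hb]; ring
      have e3 : ∑ j, x j ^ 3 = c + q₃ := by rw [hc]; ring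
      rw [e1, e2, e3, ← hs] at hm
      refine nonneg_of_mul_nonneg_right (a := ε) ?_ h0
      simp only [A, B, C]
      linarith)
  simp only [A, B, C] at key
  linarith

theorem IsNearest.deriv_nonpos {n : ℕ} {q₁ q₂ q₃ : ℝ} {x : Fin n → ℝ}
    (hx : IsNearest q₁ q₂ q₃ x) {i : Fin n} (hi : -1 < x i) :
    (∑ j, x j - q₁) + 2 * (∑ j, x j ^ 2 - q₂) * x i
      + 3 * (∑ j, x j ^ 3 - q₃) * x i ^ 2 ≤ 0 := by
  have := hx.mul_deriv_nonneg i (-1) (δ := x i + 1) (by linarith)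
    (fun ε h0 h1 => ⟨by linarith, by linarith [(hx.1 i).2]⟩)
  linarith

theorem IsNearest.deriv_nonneg {n : ℕ} {q₁ q₂ q₃ : ℝ} {x : Fin n → ℝ}
    (hx : IsNearest q₁ q₂ q₃ x) {i : Fin n} (hi : x i < 1) :
    0 ≤ (∑ j, x j - q₁) + 2 * (∑ j, x j ^ 2 - q₂) * x i
      + 3 * (∑ j, x j ^ 3 - q₃) * x i ^ 2 := by
  have := hx.mul_deriv_nonneg i 1 (δ := 1 - x i) (by linarith)
    (fun ε h0 h1 => ⟨by linarith [(hx.1 i).1], by linarith⟩)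
  linarith

theorem IsNearest.second_deriv_nonneg {n : ℕ} {q₁ q₂ q₃ : ℝ} {x : Fin n → ℝ}
    (hx : IsNearest q₁ q₂ q₃ x) {i j : Fin n} (hij : i ≠ j) (hxij : x i = x j)
    (h₁ : -1 < x i) (h₂ : x i < 1) :
    0 ≤ (∑ k, x k ^ 2 - q₂) + 3 * (∑ k, x k ^ 3 - q₃) * x i := by
  set a := ∑ k, x k - q₁ with ha
  set b := ∑ k, x k ^ 2 - q₂ with hb
  set c := ∑ k, x k ^ 3 - q₃ with hc
  have key := nonneg_at_zero_of_pos
    (F := fun ε => 4 * (b + 3 * c * x i) + ε ^ 2 * (4 + 36 * x i ^ 2))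
    (by fun_prop) (δ := min (x i + 1) (1 - x i)) (lt_min (by linarith) (by linarith))
    (fun ε h0 h1 => by
      have hl := h1.trans_le (min_le_left _ _)
      have hr := h1.trans_le (min_le_right _ _)
      have hm := hx.2 (Function.update (Function.update x i (x i + ε)) j (x i - ε))
        (fun k => by
          rcases eq_or_ne k j with rfl | hk
          · rw [Function.update_self]; constructor <;> linarith
          · rw [Function.update_of_ne hk]
            rcases eq_or_ne k i with rfl | hk'
            · rw [Function.update_self]; constructor <;> linarith
            · rw [Function.update_of_ne hk']; exact hx.1 k)
      unfold momentDistSq at hm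
      simp only [sum_comp_update (fun t => t), sum_comp_update (fun t => t ^ 2),
        sum_comp_update (fun t => t ^ 3), Function.update_of_ne hij.symm, ← hxij] at hm
      have e1 : ∑ k, x k = a + q₁ := by rw [ha]; ring
      have e2 : ∑ k, x k ^ 2 = b + q₂ := by rw [hb]; ring
      have e3 : ∑ k, x k ^ 3 = c + q₃ := by rw [hc]; ring
      rw [e1, e2, e3] at hm
      refine nonneg_of_mul_nonneg_right (a := ε ^ 2) ?_ (by positivity)
      linarith)
  rw [zero_pow two_ne_zero, zero_mul, add_zero] at key
  linarith

/-- If the cubic coefficient of the residual is nonnegative and two coordinates lie strictly between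
`-1` and another coordinate, then the residual vanishes. -/
theorem IsNearest.residual_eq_zero {n : ℕ} {q₁ q₂ q₃ : ℝ} {x : Fin n → ℝ}
    (hx : IsNearest q₁ q₂ q₃ x) (hc : 0 ≤ ∑ k, x k ^ 3 - q₃) {i j k : Fin n} (hij : i ≠ j)
    (hi : -1 < x i) (hj : -1 < x j) (hik : x i < x k) (hjk : x j < x k) :
    momentDistSq q₁ q₂ q₃ x = 0 := by
  wlog hle : x i ≤ x j generalizing i j
  · exact this hij.symm hj hi hjk hik (le_of_not_ge hle)
  have hk1 := (hx.1 k).2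
  have i1 := hx.deriv_nonpos hi
  have i2 := hx.deriv_nonneg (i := i) (by linarith)
  have j1 := hx.deriv_nonpos hj
  have j2 := hx.deriv_nonneg (i := j) (by linarith)
  have k1 := hx.deriv_nonpos (hi.trans hik)
  have s2 := fun h : x i = x j => hx.second_deriv_nonneg hij h hi (by linarith)
  unfold momentDistSq
  generalize ∑ j, x j - q₁ = a at *
  generalize ∑ j, x j ^ 2 - q₂ = b at *
  generalize ∑ j, x j ^ 3 - q₃ = c at *
  generalize x i = s at *
  generalize x j = t at *
  generalize x k = M at *
  suffices h : c = 0 ∧ b = 0 by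
    obtain ⟨rfl, rfl⟩ := h
    have : a = 0 := by linarith
    simp [this]
  rcases hle.eq_or_lt with rfl | hlt
  · have hg := s2 rfl
    have h1 : (M - s) * (2 * (b + 3 * c * s) + 3 * c * (M - s)) ≤ 0 := by linarith
    have h2 : 2 * (b + 3 * c * s) + 3 * c * (M - s) ≤ 0 :=
      nonpos_of_mul_nonpos_right h1 (by linarith)
    have h3 : 0 ≤ c * (M - s) := mul_nonneg hc (by linarith)
    have h4 : c * (M - s) = 0 := by linarith
    have hc0 : c = 0 := (mul_eq_zero.mp h4).resolve_right (by linarith)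
    subst hc0
    exact ⟨rfl, by linarith⟩
  · have h1 : (t - s) * (2 * b + 3 * c * (s + t)) = 0 := by linarith
    have h2 : 2 * b + 3 * c * (s + t) = 0 := (mul_eq_zero.mp h1).resolve_left (by linarith)
    have h3 : (M - s) * (2 * b + 3 * c * (s + M)) ≤ 0 := by linarith
    have h4 : 2 * b + 3 * c * (s + M) ≤ 0 := nonpos_of_mul_nonpos_right h3 (by linarith)
    have h5 : c * (M - t) ≤ 0 := by linarith
    have h6 : c * (M - t) = 0 := le_antisymm h5 (mul_nonneg hc (by linarith))
    have hc0 : c = 0 := (mul_eq_zero.mp h6).resolve_right (by linarith)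
    subst hc0
    exact ⟨rfl, by linarith⟩

/-- If at most one coordinate lies strictly between `-1` and the maximum, then the coordinates are
`-1` repeated, one value `s`, and one value `t ≥ s` repeated. -/
theorem exists_sum_eq_of_two_values {n : ℕ} (hn : 2 ≤ n) {x : Fin n → ℝ}
    (hx : ∀ i, -1 ≤ x i ∧ x i ≤ 1)
    (h : ∀ i j k, i ≠ j → -1 < x i → -1 < x j → x i < x k → ¬ x j < x k) :
    ∃ (s t : ℝ) (l : ℕ), -1 ≤ s ∧ s ≤ t ∧ t ≤ 1 ∧ 1 ≤ l ∧ l ≤ n - 1 ∧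
      ∀ f : ℝ → ℝ, ∑ i, f (x i) = f s + l * f t + (n - l - 1 : ℕ) * f (-1) := by
  have : Nontrivial (Fin n) := Fin.nontrivial_iff_two_le.mpr hn
  obtain ⟨k, hk⟩ := Finite.exists_max x
  obtain ⟨i, hik, hi⟩ : ∃ i, i ≠ k ∧ ∀ j, j ≠ i → x j = x k ∨ x j = -1 := by
    by_cases hex : ∃ i, -1 < x i ∧ x i < x k
    · obtain ⟨i, h1, h2⟩ := hex
      refine ⟨i, fun e => h2.ne (congrArg x e), fun j hj => ?_⟩
      by_contra! hne
      exact h i j k hj.symm h1 (lt_of_le_of_ne (hx j).1 hne.2.symm) h2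
        (lt_of_le_of_ne (hk j) hne.1)
    · obtain ⟨i, hik⟩ := exists_ne k
      refine ⟨i, hik, fun j _ => ?_⟩
      by_contra! hne
      exact hex ⟨j, lt_of_le_of_ne (hx j).1 hne.2.symm, lt_of_le_of_ne (hk j) hne.1⟩
  classical
  let S := (Finset.univ.erase i).filter (fun j => x j = x k)
  have hcard : S.card + ((Finset.univ.erase i).filter (fun j => ¬ x j = x k)).card = n - 1 := by
    rw [Finset.card_filter_add_card_filter_not, Finset.card_erase_of_mem (Finset.mem_univ i),
      Finset.card_univ, Fintype.card_fin]
  refine ⟨x i, x k, S.card, (hx i).1, hk i, (hx k).2,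
    Finset.card_pos.mpr ⟨k, by simp [S, hik.symm]⟩, by omega, fun f => ?_⟩
  rw [← Finset.add_sum_erase _ _ (Finset.mem_univ i),
    ← Finset.sum_filter_add_sum_filter_not _ (fun j => x j = x k), add_assoc]
  congr 2
  · rw [Finset.sum_congr rfl (g := fun _ => f (x k))]
    · simp [S]
    · intro j hj
      rw [(Finset.mem_filter.mp hj).2]
  · rw [Finset.sum_congr rfl (g := fun _ => f (-1))]
    · rw [Finset.sum_const, nsmul_eq_mul]
      congr 2
      omega
    · intro j hj
      rw [Finset.mem_filter] at hj
      rw [(hi j (Finset.ne_of_mem_erase hj.1)).resolve_left hj.2]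

theorem IsNearest.exists_sum_eq {n : ℕ} (hn : 2 ≤ n) {q₁ q₂ q₃ : ℝ} {x : Fin n → ℝ}
    (hx : IsNearest q₁ q₂ q₃ x) (hc : 0 ≤ ∑ k, x k ^ 3 - q₃)
    (hne : momentDistSq q₁ q₂ q₃ x ≠ 0) :
    ∃ (s t : ℝ) (l : ℕ), -1 ≤ s ∧ s ≤ t ∧ t ≤ 1 ∧ 1 ≤ l ∧ l ≤ n - 1 ∧
      ∀ f : ℝ → ℝ, ∑ i, f (x i) = f s + l * f t + (n - l - 1 : ℕ) * f (-1) :=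
  exists_sum_eq_of_two_values hn hx.1
    fun _ _ _ hij hi hj hik hjk => hne (hx.residual_eq_zero hc hij hi hj hik hjk)

theorem momentDistSq_neg {n : ℕ} (q₁ q₂ q₃ : ℝ) (x : Fin n → ℝ) :
    momentDistSq (-q₁) q₂ (-q₃) (-x) = momentDistSq q₁ q₂ q₃ x := by
  simp only [momentDistSq, Pi.neg_apply, Finset.sum_neg_distrib, even_two.neg_pow,
    Odd.neg_pow (by decide : Odd 3)]
  ring

theorem IsNearest.neg {n : ℕ} {q₁ q₂ q₃ : ℝ} {x : Fin n → ℝ} (hx : IsNearest q₁ q₂ q₃ x) :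
    IsNearest (-q₁) q₂ (-q₃) (-x) := by
  have hcube : ∀ y : Fin n → ℝ, (∀ i, -1 ≤ y i ∧ y i ≤ 1) → ∀ i, -1 ≤ (-y) i ∧ (-y) i ≤ 1 :=
    fun y hy i => ⟨neg_le_neg (hy i).2, neg_le.mp (hy i).1⟩
  refine ⟨hcube x hx.1, fun y hy => ?_⟩
  rw [momentDistSq_neg, ← neg_neg y, momentDistSq_neg]
  exact hx.2 _ (hcube y hy)

theorem IsNearest.mem_Bplus_union_Bminus {n : ℕ} (hn : 2 ≤ n) {q₁ q₂ q₃ : ℝ} {x : Fin n → ℝ}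
    (hx : IsNearest q₁ q₂ q₃ x) (hne : momentDistSq q₁ q₂ q₃ x ≠ 0) :
    (∑ i, x i, ∑ i, x i ^ 2, ∑ i, x i ^ 3) ∈ Bplus n ∪ Bminus n := by
  rcases le_total 0 (∑ k, x k ^ 3 - q₃) with hc | hc
  · obtain ⟨s, t, l, hs, hst, ht, hl, hln, hf⟩ := hx.exists_sum_eq hn hc hne
    refine Or.inr (Set.mem_iUnion₂.mpr ⟨l, Finset.mem_Icc.mpr ⟨hl, hln⟩, s, t, hs, hst, ht, ?_⟩)
    rw [hf (fun u => u), hf (fun u => u ^ 2), hf (fun u => u ^ 3)]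
    refine Prod.ext ?_ (Prod.ext ?_ ?_) <;> ring
  · have hodd : ∀ u : ℝ, (-u) ^ 3 = -u ^ 3 := fun u => by ring
    obtain ⟨s, t, l, hs, hst, ht, hl, hln, hf⟩ := hx.neg.exists_sum_eq hn
      (by simp only [Pi.neg_apply, hodd, Finset.sum_neg_distrib]; linarith)
      (by rwa [momentDistSq_neg])
    refine Or.inl (Set.mem_iUnion₂.mpr ⟨l, Finset.mem_Icc.mpr ⟨hl, hln⟩, -t, -s,
      by linarith, by linarith, by linarith, ?_⟩)
    have h1 := hf (fun u => -u)
    have h2 := hf (fun u => (-u) ^ 2)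
    have h3 := hf (fun u => (-u) ^ 3)
    simp only [Pi.neg_apply, neg_neg] at h1 h2 h3
    rw [h1, h2, h3]
    refine Prod.ext ?_ (Prod.ext ?_ ?_) <;> ring

theorem isCompact_setOf_le_le : IsCompact {p : ℝ × ℝ | -1 ≤ p.1 ∧ p.1 ≤ p.2 ∧ p.2 ≤ 1} := by
  refine (isCompact_Icc (a := ((-1, -1) : ℝ × ℝ)) (b := (1, 1))).of_isClosed_subset ?_ ?_
  · exact (isClosed_le continuous_const continuous_fst).inter
      ((isClosed_le continuous_fst continuous_snd).inter
        (isClosed_le continuous_snd continuous_const))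
  · rintro ⟨s, t⟩ ⟨h1, h2, h3⟩
    exact ⟨⟨h1, h1.trans h2⟩, ⟨h2.trans h3, h3⟩⟩

theorem isClosed_Cplus (k a : ℕ) : IsClosed (Cplus k a) := by
  convert (isCompact_setOf_le_le.image (f := fun p : ℝ × ℝ =>
    ((k : ℝ) * p.1 + p.2 + a, (k : ℝ) * p.1 ^ 2 + p.2 ^ 2 + a, (k : ℝ) * p.1 ^ 3 + p.2 ^ 3 + a))
    (by fun_prop)).isClosed using 1
  ext p
  simp only [Cplus, Set.mem_ofPred_eq, Set.mem_image, Prod.exists, eq_comm (a := p), and_assoc]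

theorem isClosed_Cminus (l b : ℕ) : IsClosed (Cminus l b) := by
  convert (isCompact_setOf_le_le.image (f := fun p : ℝ × ℝ =>
    (p.1 + (l : ℝ) * p.2 - b, p.1 ^ 2 + (l : ℝ) * p.2 ^ 2 + b, p.1 ^ 3 + (l : ℝ) * p.2 ^ 3 - b))
    (by fun_prop)).isClosed using 1
  ext p
  simp only [Cminus, Set.mem_ofPred_eq, Set.mem_image, Prod.exists, eq_comm (a := p), and_assoc]

theorem isClosed_Bplus_union_Bminus (n : ℕ) : IsClosed (Bplus n ∪ Bminus n) :=
  (isClosed_biUnion_finset fun _ _ => isClosed_Cplus _ _).union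
    (isClosed_biUnion_finset fun _ _ => isClosed_Cminus _ _)

theorem exists_isNearest (n : ℕ) (q₁ q₂ q₃ : ℝ) : ∃ x : Fin n → ℝ, IsNearest q₁ q₂ q₃ x := by
  have hcont : Continuous (momentDistSq (n := n) q₁ q₂ q₃) := by
    unfold momentDistSq
    fun_prop
  obtain ⟨x, hx, hmin⟩ := (isCompact_univ_pi fun _ : Fin n =>
    isCompact_Icc (a := (-1 : ℝ)) (b := 1)).exists_isMinOn ⟨0, fun _ _ => by simp⟩
    hcont.continuousOn
  exact ⟨x, fun i => hx i trivial, fun y hy => hmin fun i _ => hy i⟩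

theorem isClosed_A3 (n : ℕ) : IsClosed (A3 n) := by
  convert ((isCompact_univ_pi fun _ : Fin n =>
    isCompact_Icc (a := (-1 : ℝ)) (b := 1)).image (f := fun x : Fin n → ℝ =>
    (∑ i, x i, ∑ i, x i ^ 2, ∑ i, x i ^ 3)) (by fun_prop)).isClosed using 1
  ext p
  constructor
  · rintro ⟨t, ht, rfl⟩
    exact ⟨t, fun i _ => ht i, rfl⟩
  · rintro ⟨t, ht, rfl⟩
    exact ⟨t, fun i => ht i trivial, rfl⟩

theorem frontier_A3n_subset (n : ℕ) (hn : 3 ≤ n) :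
    frontier (A3 n) ⊆ Bplus n ∪ Bminus n := by
  intro p hp
  rw [← (isClosed_Bplus_union_Bminus n).closure_eq, Metric.mem_closure_iff]
  intro ε hε
  obtain ⟨y, hy, rfl⟩ := (isClosed_A3 n).frontier_subset hp
  rw [frontier_eq_closure_inter_closure] at hp
  obtain ⟨⟨q₁, q₂, q₃⟩, hq, hdist⟩ := Metric.mem_closure_iff.mp hp.2 (ε / 3) (by positivity)
  obtain ⟨x, hx⟩ := exists_isNearest n q₁ q₂ q₃
  refine ⟨_, hx.mem_Bplus_union_Bminus (by omega) fun h0 => hq ⟨x, hx.1, ?_⟩, ?_⟩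
  · unfold momentDistSq at h0
    refine Prod.ext ?_ (Prod.ext ?_ ?_) <;> simp only <;> nlinarith
  · have hm := hx.2 y hy
    simp only [Prod.dist_eq, max_lt_iff, Real.dist_eq] at hdist ⊢
    obtain ⟨d1, d2, d3⟩ := hdist
    unfold momentDistSq at hm
    generalize ∑ i, x i = u₁ at *
    generalize ∑ i, x i ^ 2 = u₂ at *
    generalize ∑ i, x i ^ 3 = u₃ at *
    generalize ∑ i, y i = v₁ at *
    generalize ∑ i, y i ^ 2 = v₂ at *
    generalize ∑ i, y i ^ 3 = v₃ at *
    have s1 := sq_lt_sq' (abs_lt.mp d1).1 (abs_lt.mp d1).2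
    have s2 := sq_lt_sq' (abs_lt.mp d2).1 (abs_lt.mp d2).2
    have s3 := sq_lt_sq' (abs_lt.mp d3).1 (abs_lt.mp d3).2
    have bound : ∀ w : ℝ, w ^ 2 ≤ 3 * (ε / 3) ^ 2 → |w| < 2 * (ε / 3) := fun w hw =>
      abs_lt_of_sq_lt_sq (by nlinarith) (by positivity)
    have near : ∀ u v q : ℝ, |v - q| < ε / 3 → (u - q) ^ 2 ≤ 3 * (ε / 3) ^ 2 → |v - u| < ε :=
      fun u v q h1 h2 => by
        have := abs_sub_le v q u
        have := bound _ h2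
        rw [abs_sub_comm q u] at *
        linarith
    refine ⟨near _ _ _ d1 ?_, near _ _ _ d2 ?_, near _ _ _ d3 ?_⟩ <;>
      nlinarith [sq_nonneg (u₁ - q₁), sq_nonneg (u₂ - q₂), sq_nonneg (u₃ - q₃)]
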